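/- (G-thin Gluing Theorem.) Let (C,D) be a pair of non-trivial line sets and suppose not both C and D are exceptional. Then (C,D) is thin if and only if (1) Θ(C) ∪ Θ(D) = QP¹, and (2) for every slope s ∈ ∂Θ(C) ∩ ∂Θ(D), at least one of C and D is s-rational. -/

import Mathlib

open OnePoint

/-- The space of slopes `QP¹ = ℚ ∪ {∞}`. -/
abbrev QP1 : Type := OnePoint ℚ

/-- `Incr3 x y z` means `(x,y,z)` is an increasing triple of pairwise distinct slopes
in the counter-clockwise cyclic order on `QP¹`. -/
def Incr3 : QP1 → QP1 → QP1 → Prop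
  | Option.some a, Option.some b, Option.some c =>
      (a < b ∧ b < c) ∨ (b < c ∧ c < a) ∨ (c < a ∧ a < b)
  | Option.some a, Option.some b, Option.none => a < b
  | Option.some a, Option.none, Option.some c => c < a
  | Option.none, Option.some b, Option.some c => b < c
  | _, _, _ => False

/-- A line: a slope together with a grading in `G` and a bit `ε`, which is `false`
for rational lines and `true` for special ones. -/
structure Line (G : Type*) where
  slope : QP1
  grade : G
  eps : Bool

/-- The `G`-action on lines: `n · (s, g, ε) = (s, g + n, ε)`. -/
def Line.shift {G : Type*} [Add G] (c : Line G) (n : G) : Line G :=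
  ⟨c.slope, c.grade + n, c.eps⟩

/-- The axioms (symmetry, transitivity, linearity) for a grading function. -/
structure IsGradingFunction {G : Type*} [CommRing G] (gr : Line G → Line G → G) : Prop where
  symm_eq : ∀ c c' : Line G, c.slope = c'.slope → gr c c' + gr c' c = 0
  symm_ne : ∀ c c' : Line G, c.slope ≠ c'.slope → gr c c' + gr c' c = -1
  trans : ∀ c c' c'' : Line G, Incr3 c.slope c'.slope c''.slope →
      gr c c' + gr c' c'' = gr c c''
  linear : ∀ (n n' : G) (c c' : Line G),
      gr (c.shift n) (c'.shift n') = gr c c' + n' - n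

/-- `G ∈ {ℤ, ℤ/2}`. -/
def GoodG (G : Type*) [CommRing G] : Prop :=
  Nonempty (G ≃+* ℤ) ∨ Nonempty (G ≃+* ZMod 2)

/-- The set of supporting slopes of a set of lines. -/
def SlopesOf {G : Type*} (C : Set (Line G)) : Set QP1 := Line.slope '' C

/-- `C` is `s`-rational: every line in `C` of slope `s` is rational. -/
def SRational {G : Type*} (C : Set (Line G)) (s : QP1) : Prop :=
  ∀ c ∈ C, c.slope = s → c.eps = false

/-- `C` is `s`-special: every line in `C` of slope `s` is special. -/
def SSpecial {G : Type*} (C : Set (Line G)) (s : QP1) : Prop :=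
  ∀ c ∈ C, c.slope = s → c.eps = true

/-- `C` is `s`-consistent with respect to the grading function `gr`. -/
def Consistent {G : Type*} [CommRing G] (gr : Line G → Line G → G) (C : Set (Line G)) (s : QP1) :
    Prop :=
  ∀ c ∈ C, ∀ c' ∈ C, c.slope = s → c'.slope = s → gr c c' = 0

/-- A trivial line set: all lines special and concentrated in a single slope. -/
def TrivialLineSet {G : Type*} (C : Set (Line G)) : Prop :=
  ∃ s : QP1, SlopesOf C = {s} ∧ SSpecial C s

/-- The pair `(C, D)` is thin with respect to `gr`. -/
def ThinPair {G : Type*} [CommRing G] (gr : Line G → Line G → G) (C D : Set (Line G)) : Prop :=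
  ∃ n : G, ∀ c ∈ C, ∀ d ∈ D,
    (c.slope = d.slope → c.eps ≠ d.eps) ∧ (c.slope ≠ d.slope → gr c d = n)

/-- The thin filling space `Θ(C)` of a set of lines. -/
def Theta {G : Type*} [CommRing G] (gr : Line G → Line G → G) (C : Set (Line G)) :
    Set QP1 :=
  {s | ThinPair gr {⟨s, 0, false⟩} C}

open scoped Classical in
/-- The open interval `(a, b)` in `QP¹`, with the convention `(a, a) = QP¹ ∖ {a}`. -/
noncomputable def Intvl (a b : QP1) : Set QP1 :=
  if a = b then {a}ᶜ else {s | Incr3 a s b}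

/-- An interval in `QP¹`: one of `(a,b)`, `[a,b)`, `(a,b]`, `[a,b]`, containing
at least two points. -/
def IsInterval (X : Set QP1) : Prop :=
  X.Nontrivial ∧ ∃ a b : QP1,
    X = Intvl a b ∨ X = insert a (Intvl a b) ∨ X = insert b (Intvl a b) ∨
      X = insert a (insert b (Intvl a b))

/-- Exceptional line sets. -/
def Exceptional {G : Type*} [CommRing G] (gr : Line G → Line G → G) (C : Set (Line G)) : Prop :=
  ∃ s s' : QP1, s ≠ s' ∧ SlopesOf C = {s, s'} ∧
    Consistent gr C s ∧ Consistent gr C s' ∧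
    ∃ c ∈ C, ∃ c' ∈ C, c.slope = s ∧ c'.slope = s' ∧ gr c c' ≠ 0 ∧ gr c' c ≠ 0

/-- Reduction of lines modulo 2: `(s, g, ε) ↦ (s, g mod 2, ε)`. -/
def redLine (c : Line ℤ) : Line (ZMod 2) := ⟨c.slope, (c.grade : ZMod 2), c.eps⟩

theorem incr_rot {a b c : QP1} (h : Incr3 a b c) : Incr3 b c a := by
  rcases a with _ | a <;> rcases b with _ | b <;> rcases c with _ | c <;>
    simp only [Incr3] at h ⊢ <;> grind

theorem incr_trans {a b c d : QP1} (h : Incr3 a b c) (h' : Incr3 a c d) : Incr3 a b d := by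
  rcases a with _ | a <;> rcases b with _ | b <;> rcases c with _ | c <;>
    rcases d with _ | d <;>
    simp only [Incr3] at h h' ⊢ <;> grind

theorem incr_ne {a b c : QP1} (h : Incr3 a b c) : a ≠ b := by
  rintro rfl
  rcases a with _ | a <;> rcases c with _ | c <;>
    simp only [Incr3] at h <;> grind

theorem incr_asymm {a b c : QP1} (h : Incr3 a b c) : ¬ Incr3 a c b := fun h' =>
  incr_ne (incr_rot (incr_trans h h')) rfl

theorem incr_total {a b c : QP1} (h : a ≠ b) (h' : b ≠ c) (h'' : a ≠ c) :
    Incr3 a b c ∨ Incr3 a c b := by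
  rcases a with _ | a <;> rcases b with _ | b <;> rcases c with _ | c <;>
    simp only [Incr3] <;> grind

theorem incr_dense {a b : QP1} (h : a ≠ b) : ∃ x, Incr3 a x b := by
  rcases a with _ | a <;> rcases b with _ | b
  · exact absurd rfl h
  · exact ⟨Option.some (b - 1), by simp only [Incr3]; linarith⟩
  · exact ⟨Option.some (a + 1), by simp only [Incr3]; linarith⟩
  · have hab : a ≠ b := fun e => h (by rw [e])
    rcases lt_or_gt_of_ne hab with h | h
    · refine ⟨Option.some ((a + b) / 2), ?_⟩
      simp only [Incr3]
      left; constructor <;> linarith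
    · exact ⟨Option.none, by simpa only [Incr3] using h⟩

/-- a point just before `s`, after both `a` and `a'`. -/
theorem exists_before {a a' s : QP1} (h : a ≠ s) (h' : a' ≠ s) :
    ∃ x, Incr3 a x s ∧ Incr3 a' x s := by
  by_cases e : a = a'
  · subst e
    obtain ⟨x, hx⟩ := incr_dense h
    exact ⟨x, hx, hx⟩
  · rcases incr_total e h' h with h1 | h1
    · obtain ⟨x, hx⟩ := incr_dense h'
      refine ⟨x, ?_, hx⟩
      exact incr_rot (incr_trans (incr_rot (incr_rot h1)) (incr_rot (incr_rot hx)))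
    · obtain ⟨x, hx⟩ := incr_dense h
      refine ⟨x, hx, ?_⟩
      exact incr_rot (incr_trans (incr_rot h1) (incr_rot (incr_rot hx)))

/-- a point just after `s`, before both `b` and `b'`. -/
theorem exists_after {s b b' : QP1} (h : s ≠ b) (h' : s ≠ b') :
    ∃ x, Incr3 s x b ∧ Incr3 s x b' := by
  by_cases e : b = b'
  · subst e
    obtain ⟨x, hx⟩ := incr_dense h
    exact ⟨x, hx, hx⟩
  · rcases incr_total h e h' with h1 | h1
    · obtain ⟨x, hx⟩ := incr_dense h
      exact ⟨x, hx, incr_trans hx h1⟩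
    · obtain ⟨x, hx⟩ := incr_dense h'
      exact ⟨x, incr_trans hx h1, hx⟩

/-- `s` is interior to `X` in the order topology of the circle. -/
def CInt (s : QP1) (X : Set QP1) : Prop :=
  ∃ a b, Incr3 a s b ∧ ∀ x, Incr3 a x b → x ∈ X

theorem cint_of_mem_interior {s : QP1} {X : Set QP1} (h : s ∈ interior X) : CInt s X := by
  rw [mem_interior_iff_mem_nhds] at h
  induction s using OnePoint.rec with
  | infty =>
    rw [OnePoint.nhds_infty_eq] at h
    obtain ⟨h1, h2⟩ := Filter.mem_sup.1 h
    rw [Filter.mem_map, Filter.hasBasis_coclosedCompact.mem_iff] at h1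
    obtain ⟨K, ⟨hK, hK'⟩, hKX⟩ := h1
    obtain ⟨M, hM⟩ := hK'.bddAbove
    obtain ⟨m, hm⟩ := hK'.bddBelow
    refine ⟨Option.some (max M m + 1), Option.some (min M m - 1), ?_, ?_⟩
    · change min M m - 1 < max M m + 1
      have := min_le_max (a := M) (b := m)
      linarith
    · intro x hx
      rcases x with _ | x
      · exact h2
      · refine hKX (fun hxK => ?_)
        have h3 := hM hxK
        have h4 := hm hxK
        simp only [Incr3] at hx
        have := le_max_left M m
        have := min_le_right M m
        have := min_le_max (a := M) (b := m)
        rcases hx with hx | hx | hx <;> linarith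
  | coe a =>
    rw [OnePoint.nhds_coe_eq, Filter.mem_map] at h
    obtain ⟨l, u, ⟨h1, h2⟩, h3⟩ := mem_nhds_iff_exists_Ioo_subset.1 h
    refine ⟨Option.some l, Option.some u, Or.inl ⟨h1, h2⟩, ?_⟩
    intro x hx
    rcases x with _ | x
    · have : u < l := hx
      linarith
    · simp only [Incr3] at hx
      refine h3 ⟨?_, ?_⟩ <;> rcases hx with hx | hx | hx <;> linarith

section
variable {G : Type*} [CommRing G] {gr : Line G → Line G → G}

/-- the standard rational line of slope `s`. -/
def rl (G : Type*) [CommRing G] (s : QP1) : Line G := ⟨s, 0, false⟩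

theorem mem_theta {C : Set (Line G)} {s : QP1} :
    s ∈ Theta gr C ↔ (∀ c ∈ C, c.slope = s → c.eps = true) ∧
      ∀ c ∈ C, ∀ c' ∈ C, c.slope ≠ s → c'.slope ≠ s → gr (rl G s) c = gr (rl G s) c' := by
  constructor
  · rintro ⟨n, hn⟩
    refine ⟨fun c hc e => ?_, fun c hc c' hc' h h' => ?_⟩
    · have := (hn _ rfl c hc).1 e.symm
      simpa using this
    · exact ((hn _ rfl c hc).2 h.symm).trans ((hn _ rfl c' hc').2 h'.symm).symm
  · rintro ⟨h1, h2⟩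
    by_cases h : ∃ c ∈ C, c.slope ≠ s
    · obtain ⟨c, hc, hcs⟩ := h
      refine ⟨gr (rl G s) c, ?_⟩
      rintro r rfl d hd
      refine ⟨fun e => ?_, fun e => h2 d hd c hc (Ne.symm e) hcs⟩
      have := h1 d hd e.symm
      simp [this]
    · push Not at h
      refine ⟨0, ?_⟩
      rintro r rfl d hd
      refine ⟨fun e => ?_, fun e => absurd (h d hd).symm e⟩
      have := h1 d hd e.symm
      simp [this]

theorem thin_symm (hgr : IsGradingFunction gr) {C D : Set (Line G)} (h : ThinPair gr C D) :
    ThinPair gr D C := by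
  obtain ⟨n, hn⟩ := h
  refine ⟨-1 - n, fun d hd c hc => ⟨fun e => ((hn c hc d hd).1 e.symm).symm, fun e => ?_⟩⟩
  have h1 := (hn c hc d hd).2 (Ne.symm e)
  have h2 := hgr.symm_ne d c e
  linear_combination h2 - h1

theorem indep (hgr : IsGradingFunction gr) {r r' d d' : Line G} (hr : r.slope = r'.slope)
    (hd : d.slope ≠ r.slope) (hd' : d'.slope ≠ r.slope) :
    gr r d - gr r d' = gr r' d - gr r' d' := by
  obtain ⟨t, h1, h2⟩ := exists_after hd.symm hd'.symm
  have a1 := hgr.trans r (rl G t) d h1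
  have a2 := hgr.trans r (rl G t) d' h2
  have a3 := hgr.trans r' (rl G t) d (hr ▸ h1)
  have a4 := hgr.trans r' (rl G t) d' (hr ▸ h2)
  linear_combination a2 - a1 + a3 - a4

/-- Lemma A -/
theorem not_cint (hgr : IsGradingFunction gr) (h10 : (1 : G) ≠ 0) {C : Set (Line G)}
    (hC : ¬ TrivialLineSet C) {c : Line G} (hc : c ∈ C) : ¬ CInt c.slope (Theta gr C) := by
  rintro ⟨a, b, hab, hX⟩
  by_cases h : ∃ c' ∈ C, c'.slope ≠ c.slope
  · obtain ⟨c', hc', hne⟩ := h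
    obtain ⟨x, x1, x2⟩ := exists_before (incr_ne hab) hne
    obtain ⟨y, y1, y2⟩ := exists_after (incr_ne (incr_rot hab)) hne.symm
    -- a x c ; c' x c ; c y b ; c y c'
    have cyx : Incr3 c.slope y x := incr_trans y2 (incr_rot (incr_rot x2))
    have hx : x ∈ Theta gr C := hX x (by
      have := incr_trans (incr_rot (incr_rot (incr_rot x1))) hab
      exact this)
    have hy : y ∈ Theta gr C := hX y (by
      exact incr_rot (incr_trans (incr_rot (incr_rot hab)) (incr_rot (incr_rot y1))))
    have xyc' : Incr3 y c'.slope x := by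
      -- c y c', c c' x
      have h1 : Incr3 c'.slope c.slope y := incr_rot (incr_rot y2)
      have h2 : Incr3 c'.slope x y := incr_trans x2 h1
      exact incr_rot (incr_rot h2)
    have e1 := (mem_theta.1 hx).2 c hc c' hc' (incr_ne (incr_rot x1)).symm (incr_ne x2)
    have e2 := (mem_theta.1 hy).2 c hc c' hc' (incr_ne y1) (incr_ne (incr_rot y2)).symm
    have t1 := hgr.trans (rl G x) (rl G y) c' (incr_rot (incr_rot xyc'))
    have t2 := hgr.trans (rl G x) c (rl G y) (incr_rot (incr_rot cyx))
    have t3 := hgr.symm_ne c (rl G y) (incr_ne y1)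
    apply h10
    linear_combination t3 - t2 - t1 - e2 + e1
  · push Not at h
    apply hC
    refine ⟨c.slope, ?_, (mem_theta.1 (hX _ hab)).1⟩
    ext s
    constructor
    · rintro ⟨c', hc', rfl⟩
      exact h c' hc'
    · rintro rfl
      exact ⟨c, hc, rfl⟩

/-- Lemma B -/
theorem const_of_cover (hgr : IsGradingFunction gr) (h10 : (1 : G) ≠ 0) {C D : Set (Line G)}
    (hC : ¬ TrivialLineSet C) (hcov : ∀ s, s ∈ Theta gr C ∨ s ∈ Theta gr D)
    {c d d' : Line G} (hc : c ∈ C) (hd : d ∈ D) (hd' : d' ∈ D)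
    (h : d.slope ≠ c.slope) (h' : d'.slope ≠ c.slope) : gr c d = gr c d' := by
  obtain ⟨a, a1, a2⟩ := exists_before h h'
  obtain ⟨b, b1, b2⟩ := exists_after h.symm h'.symm
  have hab : Incr3 a c.slope b :=
    incr_rot (incr_rot (incr_trans b1 (incr_rot (incr_rot a1))))
  have := not_cint hgr h10 hC hc
  unfold CInt at this
  push Not at this
  obtain ⟨x, hx, hxC⟩ := this a b hab
  have hxD := (mem_theta.1 ((hcov x).resolve_left hxC)).2 d hd d' hd'
  by_cases e : x = c.slope
  · subst e
    have e1 := hxD h h'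
    have e2 := indep hgr (r := c) (r' := rl G c.slope) rfl h h'
    linear_combination e2 + e1
  · rcases incr_total (Ne.symm e) (incr_ne (incr_rot hx)) (incr_ne (incr_rot hab)) with h1 | h1
    · -- c x b
      have k1 := incr_trans h1 b1
      have k2 := incr_trans h1 b2
      have e1 := hxD (incr_ne (incr_rot k1)).symm (incr_ne (incr_rot k2)).symm
      have t1 := hgr.trans c (rl G x) d k1
      have t2 := hgr.trans c (rl G x) d' k2
      linear_combination e1 - t1 + t2
    · -- c b x, a x b  → x between a and c
      have h2 : Incr3 c.slope a x := by
        -- b c x? from b x c, b a x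
        have g1 : Incr3 b x c.slope := incr_rot h1
        have g2 : Incr3 b a x := incr_rot (incr_rot hx)
        have g3 : Incr3 x b a := incr_rot (incr_rot g2)
        have g4 : Incr3 x c.slope b := incr_rot g1
        exact incr_rot (incr_rot (incr_rot (incr_rot (incr_trans g4 g3))))
      have k1 : Incr3 c.slope d.slope x := incr_trans (incr_rot (incr_rot a1)) h2
      have k2 : Incr3 c.slope d'.slope x := incr_trans (incr_rot (incr_rot a2)) h2
      have e1 := hxD (incr_ne (incr_rot k1)) (incr_ne (incr_rot k2))
      have t1 := hgr.trans (rl G x) c d (incr_rot (incr_rot k1))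
      have t2 := hgr.trans (rl G x) c d' (incr_rot (incr_rot k2))
      linear_combination e1 + t1 - t2

theorem eps_of_cover (hgr : IsGradingFunction gr) (h10 : (1 : G) ≠ 0) {C D : Set (Line G)}
    (hC : ¬ TrivialLineSet C) (hD : ¬ TrivialLineSet D)
    (hcov : ∀ s, s ∈ Theta gr C ∨ s ∈ Theta gr D)
    (h2 : ∀ s ∈ frontier (Theta gr C) ∩ frontier (Theta gr D), SRational C s ∨ SRational D s)
    {c d : Line G} (hc : c ∈ C) (hd : d ∈ D) (e : c.slope = d.slope)
    (hs : c.slope ∈ Theta gr C) : c.eps ≠ d.eps := by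
  have hcs := (mem_theta.1 hs).1 c hc rfl
  have iC : c.slope ∉ interior (Theta gr C) :=
    fun h => not_cint hgr h10 hC hc (cint_of_mem_interior h)
  have iD : c.slope ∉ interior (Theta gr D) :=
    fun h => not_cint hgr h10 hD hd (e ▸ cint_of_mem_interior h)
  have f1 : c.slope ∈ frontier (Theta gr C) := ⟨subset_closure hs, iC⟩
  have f2 : c.slope ∈ frontier (Theta gr D) := by
    refine ⟨?_, iD⟩
    by_contra hn
    apply iC
    have : c.slope ∈ interior (Theta gr D)ᶜ := by rwa [interior_compl]
    exact interior_mono (fun x hx => (hcov x).resolve_right hx) this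
  rcases h2 _ ⟨f1, f2⟩ with h | h
  · have := h c hc rfl
    simp [hcs] at this
  · have := h d hd e.symm
    simp [hcs, this]

/-- the two-slope case. -/
theorem two_slopes (hgr : IsGradingFunction gr) {C D : Set (Line G)}
    {c c' d d' : Line G} (hc : c ∈ C) (hc' : c' ∈ C) (hd : d ∈ D) (hd' : d' ∈ D)
    (h1 : c.slope = d'.slope) (h2 : c'.slope = d.slope)
    {x y : QP1} (hx : Incr3 c.slope x d.slope) (hy : Incr3 d.slope y c.slope)
    (hxC : x ∈ Theta gr C) (hyD : y ∈ Theta gr D) : gr c d = gr c' d' := by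
  have e1 := (mem_theta.1 hxC).2 c hc c' hc' (incr_ne hx) (h2 ▸ (incr_ne (incr_rot hx)).symm)
  have e2 := (mem_theta.1 hyD).2 d hd d' hd' (incr_ne hy) (h1 ▸ (incr_ne (incr_rot hy)).symm)
  have s1 := hgr.symm_ne c (rl G x) (incr_ne hx)
  have s2 := hgr.symm_ne c' (rl G x) (h2 ▸ (incr_ne (incr_rot hx)).symm)
  have t1 := hgr.trans c (rl G x) d hx
  have t2 := hgr.trans c' (rl G y) d' (by rw [h2, ← h1]; exact hy)
  have k : Incr3 d.slope y x := incr_trans hy (incr_rot (incr_rot hx))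
  have t3 := hgr.trans c' (rl G y) (rl G x) (by rw [h2]; exact k)
  have t4 := hgr.trans (rl G y) (rl G x) d (incr_rot k)
  linear_combination s1 - s2 - t1 + t2 - t3 + t4 + e2 - e1

theorem theta_gap (hgr : IsGradingFunction gr) (h10 : (1 : G) ≠ 0) {C : Set (Line G)}
    {c c' : Line G} (hc : c ∈ C) (hc' : c' ∈ C) {x y : QP1}
    (hx : Incr3 c.slope x c'.slope) (hy : Incr3 c'.slope y c.slope)
    (hxC : x ∈ Theta gr C) (hyC : y ∈ Theta gr C) : False := by
  have e1 := (mem_theta.1 hxC).2 c hc c' hc' (incr_ne hx) (incr_ne (incr_rot hx)).symm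
  have e2 := (mem_theta.1 hyC).2 c hc c' hc' (incr_ne (incr_rot hy)).symm (incr_ne hy)
  have hne : c.slope ≠ c'.slope := (incr_ne (incr_rot (incr_rot hx))).symm
  have s1 := hgr.symm_ne c c' hne
  have t1 := hgr.trans (rl G x) c' c (incr_rot hx)
  have t2 := hgr.trans (rl G y) c c' (incr_rot hy)
  apply h10
  linear_combination s1 - t1 - t2 - e1 + e2

theorem backward (hgr : IsGradingFunction gr) (h10 : (1 : G) ≠ 0) {C D : Set (Line G)}
    (hC : ¬ TrivialLineSet C) (hD : ¬ TrivialLineSet D)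
    (hcov : ∀ s, s ∈ Theta gr C ∨ s ∈ Theta gr D)
    (h2 : ∀ s ∈ frontier (Theta gr C) ∩ frontier (Theta gr D), SRational C s ∨ SRational D s) :
    ThinPair gr C D := by
  have heps : ∀ c ∈ C, ∀ d ∈ D, c.slope = d.slope → c.eps ≠ d.eps := by
    intro c hc d hd e
    rcases hcov c.slope with h | h
    · exact eps_of_cover hgr h10 hC hD hcov h2 hc hd e h
    · exact (eps_of_cover hgr h10 hD hC (fun s => (hcov s).symm)
        (fun s hs => (h2 s ⟨hs.2, hs.1⟩).symm) hd hc e.symm (e ▸ h)).symm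
  have rowc : ∀ c ∈ C, ∀ d ∈ D, ∀ d' ∈ D, c.slope ≠ d.slope → c.slope ≠ d'.slope →
      gr c d = gr c d' := fun c hc d hd d' hd' h h' =>
    const_of_cover hgr h10 hC hcov hc hd hd' h.symm h'.symm
  have colc : ∀ d ∈ D, ∀ c ∈ C, ∀ c' ∈ C, c.slope ≠ d.slope → c'.slope ≠ d.slope →
      gr c d = gr c' d := by
    intro d hd c hc c' hc' h h'
    have := const_of_cover hgr h10 hD (fun s => (hcov s).symm) hd hc hc' h h'
    have s1 := hgr.symm_ne c d h
    have s2 := hgr.symm_ne c' d h'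
    linear_combination s1 - s2 - this
  have key : ∀ c ∈ C, ∀ d ∈ D, ∀ c' ∈ C, ∀ d' ∈ D, c.slope ≠ d.slope → c'.slope ≠ d'.slope →
      gr c d = gr c' d' := by
    intro c hc d hd c' hc' d' hd' h h'
    by_cases a1 : c.slope = d'.slope
    · by_cases a2 : c'.slope = d.slope
      · obtain ⟨x, hx⟩ := incr_dense h
        obtain ⟨y, hy⟩ := incr_dense h.symm
        rcases hcov x with hx' | hx' <;> rcases hcov y with hy' | hy'
        · exact (theta_gap hgr h10 hc hc' (a2 ▸ hx) (a2 ▸ hy) hx' hy').elim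
        · exact two_slopes hgr hc hc' hd hd' a1 a2 hx hy hx' hy'
        · refine (two_slopes hgr hc' hc hd' hd a2 a1 ?_ ?_ hy' hx').symm
          · rw [a2, ← a1]; exact hy
          · rw [a2, ← a1]; exact hx
        · exact (theta_gap hgr h10 hd' hd (a1 ▸ hx) (a1 ▸ hy) hx' hy').elim
      · exact (colc d hd c hc c' hc' h a2).trans (rowc c' hc' d hd d' hd' a2 h')
    · exact (rowc c hc d hd d' hd' h a1).trans (colc d' hd' c hc c' hc' a1 h')
  by_cases hex : ∃ c ∈ C, ∃ d ∈ D, c.slope ≠ d.slope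
  · obtain ⟨c, hc, d, hd, h⟩ := hex
    exact ⟨gr c d, fun c' hc' d' hd' => ⟨heps c' hc' d' hd',
      fun h' => key c' hc' d' hd' c hc d hd h' h⟩⟩
  · push Not at hex
    exact ⟨0, fun c' hc' d' hd' => ⟨heps c' hc' d' hd', fun h' => absurd (hex c' hc' d' hd') h'⟩⟩

theorem rational_of_thin (hgr : IsGradingFunction gr) {C D : Set (Line G)}
    (h : ThinPair gr C D) {c : Line G} (hc : c ∈ C) (hs : c.slope ∉ Theta gr D) :
    ∃ d ∈ D, d.slope = c.slope ∧ d.eps = false := by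
  by_contra hn
  push Not at hn
  apply hs
  rw [mem_theta]
  obtain ⟨n, h⟩ := h
  refine ⟨fun d hd e => by simpa using hn d hd e, fun d hd d' hd' e e' => ?_⟩
  have h1 := (h c hc d hd).2 e.symm
  have h2 := (h c hc d' hd').2 e'.symm
  have h3 := indep hgr (r := c) (r' := rl G c.slope) rfl e e'
  linear_combination h1 - h2 - h3

theorem no_lines (hgr : IsGradingFunction gr) {C D : Set (Line G)}
    (h : ThinPair gr C D) {s : QP1} (hC : s ∉ Theta gr C) (hD : s ∉ Theta gr D) :
    ∀ c ∈ C, c.slope ≠ s := by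
  rintro c hc rfl
  obtain ⟨d, hd, e, he⟩ := rational_of_thin hgr h hc hD
  obtain ⟨c', hc', e', he'⟩ := rational_of_thin hgr (thin_symm hgr h) hd (e ▸ hC)
  obtain ⟨n, h⟩ := h
  exact (h c' hc' d hd).1 e' (by rw [he, he'])

theorem key_aux (hgr : IsGradingFunction gr) {C D : Set (Line G)} {s : QP1}
    (hCs : ∀ c ∈ C, c.slope ≠ s) (hDs : ∀ c ∈ D, c.slope ≠ s) (h : ThinPair gr C D)
    {c1 c2 d : Line G} (hc1 : c1 ∈ C) (hc2 : c2 ∈ C) (hd : d ∈ D)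
    (hne : gr (rl G s) c1 ≠ gr (rl G s) c2)
    (h1 : Incr3 s c1.slope d.slope) (h2 : Incr3 s d.slope c2.slope) :
    ∃ m, ∀ d' ∈ D, gr (rl G s) d' = m := by
  obtain ⟨n, h⟩ := h
  have up : ∀ c ∈ C, ∀ d ∈ D, Incr3 s c.slope d.slope →
      gr (rl G s) d = n + gr (rl G s) c := by
    intro c hc d hd h'
    have e1 := (h c hc d hd).2 (incr_ne (incr_rot h'))
    have t := hgr.trans (rl G s) c d h'
    linear_combination e1 - t
  have dn : ∀ c ∈ C, ∀ d ∈ D, Incr3 s d.slope c.slope →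
      gr (rl G s) d = n + gr (rl G s) c + 1 := by
    intro c hc d hd h'
    have e1 := (h c hc d hd).2 (incr_ne (incr_rot h')).symm
    have t := hgr.trans (rl G s) d c h'
    have s1 := hgr.symm_ne c d (incr_ne (incr_rot h')).symm
    linear_combination t - s1 + e1
  have h12 := incr_trans h1 h2
  have a1 := up c1 hc1 d hd h1
  have a2 := dn c2 hc2 d hd h2
  refine ⟨gr (rl G s) d, fun d' hd' => ?_⟩
  by_cases e : d'.slope = c1.slope
  · rw [a2]
    exact dn c2 hc2 d' hd' (e ▸ h12)
  · rcases incr_total (hDs d' hd').symm e (hCs c1 hc1).symm with k | k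
    · exfalso
      apply hne
      have b1 := dn c1 hc1 d' hd' k
      have b2 := dn c2 hc2 d' hd' (incr_trans k h12)
      linear_combination b2 - b1
    · rw [a1]
      exact up c1 hc1 d' hd' k

theorem key_slopes (hgr : IsGradingFunction gr) {C D : Set (Line G)} {s : QP1}
    (hCs : ∀ c ∈ C, c.slope ≠ s) (hDs : ∀ c ∈ D, c.slope ≠ s) (h : ThinPair gr C D)
    {c1 c2 d1 d2 : Line G} (hc1 : c1 ∈ C) (hc2 : c2 ∈ C)
    (hd1 : d1 ∈ D) (hd2 : d2 ∈ D)
    (hne : gr (rl G s) c1 ≠ gr (rl G s) c2) (hne' : gr (rl G s) d1 ≠ gr (rl G s) d2) :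
    ∀ d ∈ D, d.slope = c1.slope ∨ d.slope = c2.slope := by
  intro d hd
  by_contra hn
  push Not at hn
  obtain ⟨n1, n2⟩ := hn
  have fin : ¬ ∃ m, ∀ d' ∈ D, gr (rl G s) d' = m := fun ⟨m, hm⟩ =>
    hne' ((hm d1 hd1).trans (hm d2 hd2).symm)
  rcases incr_total (hDs d hd).symm n1 (hCs c1 hc1).symm with k1 | k1 <;>
    rcases incr_total (hDs d hd).symm n2 (hCs c2 hc2).symm with k2 | k2
  · obtain ⟨n, h⟩ := h
    have t1 := hgr.trans (rl G s) d c1 k1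
    have t2 := hgr.trans (rl G s) d c2 k2
    have s1 := hgr.symm_ne c1 d n1.symm
    have s2 := hgr.symm_ne c2 d n2.symm
    have e1 := (h c1 hc1 d hd).2 n1.symm
    have e2 := (h c2 hc2 d hd).2 n2.symm
    apply hne
    linear_combination t2 - t1 + s1 - s2 - e1 + e2
  · exact fin (key_aux hgr hCs hDs h hc2 hc1 hd hne.symm k2 k1)
  · exact fin (key_aux hgr hCs hDs h hc1 hc2 hd hne k1 k2)
  · obtain ⟨n, h⟩ := h
    have t1 := hgr.trans (rl G s) c1 d k1
    have t2 := hgr.trans (rl G s) c2 d k2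
    have e1 := (h c1 hc1 d hd).2 n1.symm
    have e2 := (h c2 hc2 d hd).2 n2.symm
    apply hne
    linear_combination t1 - t2 - e1 + e2

/-- what we use about `G`. -/
theorem goodG_cases (hG : GoodG G) :
    (1 : G) ≠ 0 ∧ ((∀ x : G, x + x = 0 → x = 0) ∨ ∀ x y : G, x ≠ 0 → y ≠ 0 → x + y ≠ -1) := by
  rcases hG with ⟨⟨f⟩⟩ | ⟨⟨f⟩⟩
  · refine ⟨fun h => ?_, Or.inl fun x hx => ?_⟩
    · have := congrArg f h
      simp at this
    · apply f.injective
      have := congrArg f hx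
      simp only [map_add, map_zero] at this ⊢
      omega
  · refine ⟨fun h => ?_, Or.inr fun x y hx hy h => ?_⟩
    · have := congrArg f h
      simp at this
    · have h := congrArg f h
      rw [← f.map_ne_zero_iff] at hx hy
      simp only [map_add, map_neg, map_one] at h
      revert h hx hy
      generalize f x = a
      generalize f y = b
      revert a b
      decide

theorem not_theta_of_thin (hgr : IsGradingFunction gr) (hG : GoodG G) {C D : Set (Line G)}
    (hC : ¬ TrivialLineSet C) (hD : ¬ TrivialLineSet D)
    (h : ThinPair gr C D) {s : QP1} (hsC : s ∉ Theta gr C) (hsD : s ∉ Theta gr D) :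
    Exceptional gr C := by
  have hCs := no_lines hgr h hsC hsD
  have hDs := no_lines hgr (thin_symm hgr h) hsD hsC
  have exC : ∃ c1 ∈ C, ∃ c2 ∈ C, gr (rl G s) c1 ≠ gr (rl G s) c2 := by
    by_contra hn
    push Not at hn
    exact hsC (mem_theta.2 ⟨fun c hc e => absurd e (hCs c hc),
      fun c hc c' hc' _ _ => hn c hc c' hc'⟩)
  have exD : ∃ c1 ∈ D, ∃ c2 ∈ D, gr (rl G s) c1 ≠ gr (rl G s) c2 := by
    by_contra hn
    push Not at hn
    exact hsD (mem_theta.2 ⟨fun c hc e => absurd e (hDs c hc),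
      fun c hc c' hc' _ _ => hn c hc c' hc'⟩)
  obtain ⟨c1, hc1, c2, hc2, hc⟩ := exC
  obtain ⟨d1, hd1, d2, hd2, hd⟩ := exD
  have KD : ∀ c ∈ C, ∀ c' ∈ C, gr (rl G s) c ≠ gr (rl G s) c' →
      ∀ d ∈ D, d.slope = c.slope ∨ d.slope = c'.slope := fun c hc c' hc' hne =>
    key_slopes hgr hCs hDs h hc hc' hd1 hd2 hne hd
  have KC : ∀ c ∈ D, ∀ c' ∈ D, gr (rl G s) c ≠ gr (rl G s) c' →
      ∀ d ∈ C, d.slope = c.slope ∨ d.slope = c'.slope := fun c hc' c' hc'' hne =>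
    key_slopes hgr hDs hCs (thin_symm hgr h) hc' hc'' hc1 hc2 hne hc
  obtain ⟨n, h⟩ := h
  -- not everything is in a single slope
  have single : ∀ p, ¬ ((∀ c ∈ C, c.slope = p) ∧ ∀ d ∈ D, d.slope = p) := by
    rintro p ⟨hp, hp'⟩
    have slC : SlopesOf C = {p} := by
      ext t
      exact ⟨fun ⟨c, hc, e⟩ => e ▸ hp c hc, fun e => ⟨c1, hc1, (hp c1 hc1).trans e.symm⟩⟩
    have slD : SlopesOf D = {p} := by
      ext t
      exact ⟨fun ⟨c, hc, e⟩ => e ▸ hp' c hc, fun e => ⟨d1, hd1, (hp' d1 hd1).trans e.symm⟩⟩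
    have eps : ∀ c ∈ C, ∀ d ∈ D, c.eps ≠ d.eps := fun c hc d hd =>
      (h c hc d hd).1 ((hp c hc).trans (hp' d hd).symm)
    cases hb : c1.eps
    · refine hD ⟨p, slD, fun d hd _ => ?_⟩
      have := eps c1 hc1 d hd
      rw [hb] at this
      simpa using this.symm
    · refine hC ⟨p, slC, fun c hc _ => ?_⟩
      have h1 := eps c1 hc1 d1 hd1
      have h2 := eps c hc d1 hd1
      rw [hb] at h1
      revert h1 h2
      cases c.eps <;> cases d1.eps <;> simp
  have sepD : ∀ c ∈ D, ∀ c' ∈ D, gr (rl G s) c ≠ gr (rl G s) c' → c.slope ≠ c'.slope := by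
    intro d hd d' hd' hne e
    have q1 := KC d hd d' hd' hne
    refine single d.slope ⟨fun c hc => by rcases q1 c hc with h | h <;> simp [h, e], ?_⟩
    have : ∀ c ∈ C, c.slope = d.slope := fun c hc => by rcases q1 c hc with h | h <;> simp [h, e]
    intro x hx
    rcases KD c1 hc1 c2 hc2 hc x hx with h | h
    · rw [h, this c1 hc1]
    · rw [h, this c2 hc2]
  have sepC : ∀ c ∈ C, ∀ c' ∈ C, gr (rl G s) c ≠ gr (rl G s) c' → c.slope ≠ c'.slope := by
    intro d hd' d' hd'' hne e
    have q1 := KD d hd' d' hd'' hne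
    have : ∀ c ∈ D, c.slope = d.slope := fun c hc => by rcases q1 c hc with h | h <;> simp [h, e]
    refine single d.slope ⟨?_, this⟩
    intro x hx
    rcases KC d1 hd1 d2 hd2 hd x hx with h | h
    · rw [h, this d1 hd1]
    · rw [h, this d2 hd2]
  -- arrange that `c1` comes before `c2`
  have hor : ∃ c ∈ C, ∃ c' ∈ C, gr (rl G s) c ≠ gr (rl G s) c' ∧ Incr3 s c.slope c'.slope := by
    rcases incr_total (hCs c1 hc1).symm (sepC c1 hc1 c2 hc2 hc) (hCs c2 hc2).symm with k | k
    · exact ⟨c1, hc1, c2, hc2, hc, k⟩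
    · exact ⟨c2, hc2, c1, hc1, hc.symm, k⟩
  clear! c1 c2
  obtain ⟨c1, hc1, c2, hc2, hc, hlt⟩ := hor
  have hpq := sepC c1 hc1 c2 hc2 hc
  -- arrange that `d1` has the slope of `c1`, `d2` that of `c2`
  have hor : ∃ d ∈ D, ∃ d' ∈ D, gr (rl G s) d ≠ gr (rl G s) d' ∧
      d.slope = c1.slope ∧ d'.slope = c2.slope := by
    have hdd := sepD d1 hd1 d2 hd2 hd
    rcases KD c1 hc1 c2 hc2 hc d1 hd1 with k1 | k1 <;>
      rcases KD c1 hc1 c2 hc2 hc d2 hd2 with k2 | k2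
    · exact absurd (k1.trans k2.symm) hdd
    · exact ⟨d1, hd1, d2, hd2, hd, k1, k2⟩
    · exact ⟨d2, hd2, d1, hd1, hd.symm, k2, k1⟩
    · exact absurd (k1.trans k2.symm) hdd
  clear! d1 d2
  obtain ⟨d1, hd1, d2, hd2, hd, e1, e2⟩ := hor
  have slC : ∀ c ∈ C, c.slope = c1.slope ∨ c.slope = c2.slope := by
    intro c hcC
    rw [← e1, ← e2]
    exact KC d1 hd1 d2 hd2 hd c hcC
  have T := hgr.trans (rl G s) c1 c2 hlt
  have T12 := hgr.trans (rl G s) c1 d2 (e2 ▸ hlt)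
  have T21 := hgr.trans (rl G s) d1 c2 (e1 ▸ hlt)
  have S := hgr.symm_ne c1 c2 hpq
  have S21 := hgr.symm_ne c2 d1 (e1 ▸ hpq.symm)
  have N12 := (h c1 hc1 d2 hd2).2 (e2 ▸ hpq)
  have N21 := (h c2 hc2 d1 hd1).2 (e1 ▸ hpq.symm)
  have z1 : gr c1 c2 ≠ 0 := fun hz => hc (by linear_combination T - hz)
  have z2 : gr c2 c1 ≠ 0 := fun hz => hd (by
    linear_combination T21 - S21 + N21 + T12 - N12 - T + S - hz)
  rcases (goodG_cases hG).2 with hG' | hG'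
  · have cons : ∀ p, Consistent gr C p := by
      intro p c hcC c' hcC' hp hp'
      have heps : c.eps = c'.eps := by
        have aux : ∀ d ∈ D, d.slope = p → c.eps = c'.eps := by
          intro d hd hdp
          have h1 := (h c hcC d hd).1 (hp.trans hdp.symm)
          have h2 := (h c' hcC' d hd).1 (hp'.trans hdp.symm)
          revert h1 h2
          cases c.eps <;> cases c'.eps <;> cases d.eps <;> simp
        rcases slC c hcC with k | k
        · exact aux d1 hd1 (by rw [e1, ← k, hp])
        · exact aux d2 hd2 (by rw [e2, ← k, hp])
      have hphi : gr (rl G s) c = gr (rl G s) c' := by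
        by_contra hne
        exact sepC c hcC c' hcC' hne (hp.trans hp'.symm)
      have hsh : c' = c.shift (c'.grade - c.grade) := by
        rcases c with ⟨a, g, e⟩
        rcases c' with ⟨a', g', e'⟩
        simp only at hp hp' heps
        simp [Line.shift, hp, hp', heps]
      have hrl : (rl G s).shift 0 = rl G s := by simp [Line.shift, rl]
      have hl := hgr.linear 0 (c'.grade - c.grade) (rl G s) c
      rw [← hsh, hrl] at hl
      have hz : c'.grade - c.grade = 0 := by linear_combination - hl - hphi
      have hcc : c' = c := by
        rw [hsh, hz]
        simp [Line.shift]
      rw [hcc]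
      exact hG' _ (hgr.symm_eq c c rfl)
    refine ⟨c1.slope, c2.slope, hpq, ?_, cons _, cons _, c1, hc1, c2, hc2, rfl, rfl, z1, z2⟩
    ext t
    constructor
    · rintro ⟨c, hcC, rfl⟩
      exact slC c hcC
    · rintro (rfl | rfl)
      · exact ⟨c1, hc1, rfl⟩
      · exact ⟨c2, hc2, rfl⟩
  · exact absurd S (hG' _ _ z1 z2)

end

/-- `G`-thin Gluing Theorem. -/
theorem statement13 (G : Type*) [CommRing G] (hG : GoodG G)
    (gr : Line G → Line G → G) (hgr : IsGradingFunction gr)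
    (C D : Set (Line G)) (hCfin : C.Finite) (hCne : C.Nonempty)
    (hDfin : D.Finite) (hDne : D.Nonempty)
    (hCnt : ¬ TrivialLineSet C) (hDnt : ¬ TrivialLineSet D)
    (hexc : ¬ (Exceptional gr C ∧ Exceptional gr D)) :
    ThinPair gr C D ↔
      (Theta gr C ∪ Theta gr D = Set.univ ∧
        ∀ s ∈ frontier (Theta gr C) ∩ frontier (Theta gr D),
          SRational C s ∨ SRational D s) := by
  constructor
  · intro h
    constructor
    · rw [Set.eq_univ_iff_forall]
      intro s
      by_contra hn
      rw [Set.mem_union, not_or] at hn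
      exact hexc ⟨not_theta_of_thin hgr hG hCnt hDnt h hn.1 hn.2,
        not_theta_of_thin hgr hG hDnt hCnt (thin_symm hgr h) hn.2 hn.1⟩
    · intro s _
      obtain ⟨n, h⟩ := h
      by_contra hn
      rw [not_or] at hn
      obtain ⟨h1, h2⟩ := hn
      unfold SRational at h1 h2
      push Not at h1 h2
      obtain ⟨c, hc, e1, f1⟩ := h1
      obtain ⟨d, hd, e2, f2⟩ := h2
      refine (h c hc d hd).1 (e1.trans e2.symm) ?_
      revert f1 f2
      cases c.eps <;> cases d.eps <;> simp
  · rintro ⟨h1, h2⟩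
    rw [Set.eq_univ_iff_forall] at h1
    exact backward hgr (goodG_cases hG).1 hCnt hDnt h1 h2
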